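/- The supremum of the pentagonal ratio (p_{12}·p_{13}·p_{23}·p_{44}·p_{45}·p_{55})/(p_{14}·p_{15}·p_{24}·p_{25}·p_{34}·p_{35}), taken over all 5×5 Lorentzian matrices (p_{ij}) with all entries positive, equals 4; that is, the ratio is at most 4 for every such matrix, and for every c < 4 there is a 5×5 Lorentzian matrix with positive entries whose pentagonal ratio exceeds c. -/

import Mathlib

/-- A Lorentzian matrix: real symmetric with nonnegative entries and at most one
positive eigenvalue (counted with multiplicity). -/
def IsLorentzian {n : ℕ} (M : Matrix (Fin n) (Fin n) ℝ) : Prop :=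
  M.IsSymm ∧ (∀ i j, 0 ≤ M i j) ∧
    ∀ (hM : M.IsHermitian),
      (Finset.univ.filter fun i => 0 < hM.eigenvalues i).card ≤ 1

theorem Complex.normSq_dot_le (u v : Fin 3 → ℂ) :
    Complex.normSq (u 0 * v 0 + u 1 * v 1 + u 2 * v 2) ≤
      (Complex.normSq (u 0) + Complex.normSq (u 1) + Complex.normSq (u 2)) *
      (Complex.normSq (v 0) + Complex.normSq (v 1) + Complex.normSq (v 2)) := by
  have key : (Complex.normSq (u 0) + Complex.normSq (u 1) + Complex.normSq (u 2)) *
      (Complex.normSq (v 0) + Complex.normSq (v 1) + Complex.normSq (v 2)) =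
      Complex.normSq (u 0 * v 0 + u 1 * v 1 + u 2 * v 2) +
      Complex.normSq (u 0 * star (v 1) - u 1 * star (v 0)) +
      Complex.normSq (u 0 * star (v 2) - u 2 * star (v 0)) +
      Complex.normSq (u 1 * star (v 2) - u 2 * star (v 1)) := by
    simp [Complex.normSq_apply]
    ring
  rw [key]
  have h1 := Complex.normSq_nonneg (u 0 * star (v 1) - u 1 * star (v 0))
  have h2 := Complex.normSq_nonneg (u 0 * star (v 2) - u 2 * star (v 0))
  have h3 := Complex.normSq_nonneg (u 1 * star (v 2) - u 2 * star (v 1))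
  linarith

theorem Complex.normSq_cross_le (u v : Fin 3 → ℂ) :
    Complex.normSq (u 1 * v 2 - u 2 * v 1) + Complex.normSq (u 2 * v 0 - u 0 * v 2) +
        Complex.normSq (u 0 * v 1 - u 1 * v 0) ≤
      (Complex.normSq (u 0) + Complex.normSq (u 1) + Complex.normSq (u 2)) *
      (Complex.normSq (v 0) + Complex.normSq (v 1) + Complex.normSq (v 2)) := by
  have key : (Complex.normSq (u 0) + Complex.normSq (u 1) + Complex.normSq (u 2)) *
      (Complex.normSq (v 0) + Complex.normSq (v 1) + Complex.normSq (v 2)) =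
      Complex.normSq (u 1 * v 2 - u 2 * v 1) + Complex.normSq (u 2 * v 0 - u 0 * v 2) +
        Complex.normSq (u 0 * v 1 - u 1 * v 0) +
      Complex.normSq (u 0 * star (v 0) + u 1 * star (v 1) + u 2 * star (v 2)) := by
    simp [Complex.normSq_apply]
    ring
  rw [key]
  linarith [Complex.normSq_nonneg (u 0 * star (v 0) + u 1 * star (v 1) + u 2 * star (v 2))]

/-- Hadamard's inequality for the weighted Vandermonde matrix with rows
`(√k ξ², √l ξη, √m η²)`. -/
theorem vandermonde_hadamard {k l m : ℝ} (hk : 0 ≤ k) (hl : 0 ≤ l) (hm : 0 ≤ m)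
    (ξ η : Fin 3 → ℂ) :
    k * l * m * (Complex.normSq (ξ 0 * η 1 - ξ 1 * η 0) * Complex.normSq (ξ 0 * η 2 - ξ 2 * η 0) *
        Complex.normSq (ξ 1 * η 2 - ξ 2 * η 1)) ≤
      ∏ i, (k * Complex.normSq (ξ i) ^ 2 + l * (Complex.normSq (ξ i) * Complex.normSq (η i)) +
        m * Complex.normSq (η i) ^ 2) := by
  let r : Fin 3 → Fin 3 → ℂ := fun i => ![√k * ξ i ^ 2, √l * (ξ i * η i), √m * η i ^ 2]
  have hr (i) : Complex.normSq (r i 0) + Complex.normSq (r i 1) + Complex.normSq (r i 2) =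
      k * Complex.normSq (ξ i) ^ 2 + l * (Complex.normSq (ξ i) * Complex.normSq (η i)) +
        m * Complex.normSq (η i) ^ 2 := by
    simp [r, Complex.normSq_ofReal, Real.mul_self_sqrt, hk, hl, hm]
  let d : Fin 3 → ℂ := ![r 1 1 * r 2 2 - r 1 2 * r 2 1, r 1 2 * r 2 0 - r 1 0 * r 2 2,
    r 1 0 * r 2 1 - r 1 1 * r 2 0]
  have h1 := Complex.normSq_dot_le (r 0) d
  have h2 := Complex.normSq_cross_le (r 1) (r 2)
  have h3 : r 0 0 * d 0 + r 0 1 * d 1 + r 0 2 * d 2 = √k * √l * √m *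
      ((ξ 0 * η 1 - ξ 1 * η 0) * (ξ 0 * η 2 - ξ 2 * η 0) * (ξ 1 * η 2 - ξ 2 * η 1)) := by
    simp [r, d]
    ring
  rw [h3] at h1
  simp only [map_mul, Complex.normSq_ofReal, Real.mul_self_sqrt hk, Real.mul_self_sqrt hl,
    Real.mul_self_sqrt hm] at h1
  rw [Fin.prod_univ_three, ← hr 0, ← hr 1, ← hr 2, mul_assoc (_ + _ + _)]
  refine h1.trans (mul_le_mul_of_nonneg_left h2 ?_)
  exact add_nonneg (add_nonneg (Complex.normSq_nonneg _) (Complex.normSq_nonneg _))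
    (Complex.normSq_nonneg _)

/-- Minors of a nonnegative ternary quadratic form. -/
theorem ternary_minors {a b c d e f : ℝ}
    (h : ∀ x y z : ℝ, 0 ≤ a * x ^ 2 + b * y ^ 2 + c * z ^ 2 +
      2 * (d * (x * y) + e * (x * z) + f * (y * z))) :
    0 ≤ a ∧ 0 ≤ b ∧ 0 ≤ c ∧ d ^ 2 ≤ a * b ∧ e ^ 2 ≤ a * c ∧ f ^ 2 ≤ b * c ∧
      (0 < c → (c * d - e * f) ^ 2 ≤ (a * c - e ^ 2) * (b * c - f ^ 2)) := by
  have binary (A B C : ℝ) (hq : ∀ x y : ℝ, 0 ≤ A * x ^ 2 + B * y ^ 2 + 2 * C * (x * y)) :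
      C ^ 2 ≤ A * B := by
    have h1 : ∀ x : ℝ, 0 ≤ A * (x * x) + 2 * C * x + B := fun x => by
      have := hq x 1
      linarith
    have := discrim_le_zero h1
    unfold discrim at this
    linarith
  refine ⟨by simpa using h 1 0 0, by simpa using h 0 1 0, by simpa using h 0 0 1,
    binary _ _ _ fun x y => ?_, binary _ _ _ fun x y => ?_, binary _ _ _ fun x y => ?_,
    fun hc => binary _ _ _ fun x y => ?_⟩
  · linarith [h x y 0]
  · linarith [h x 0 y]
  · linarith [h 0 x y]
  · have h1 := mul_nonneg hc.le (h x y (-(e * x + f * y) / c))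
    have hc0 := hc.ne'
    refine h1.trans_eq ?_
    field_simp
    ring

/-- Three vectors with given squared norms can be laid out in the plane, preserving two of the inner
products and not increasing the third one. -/
theorem exists_planar_gram {a b c d e f : ℝ} (ha : 0 ≤ a) (hb : 0 ≤ b)
    (hc : 0 ≤ c) (he : e ^ 2 ≤ a * c) (hf : f ^ 2 ≤ b * c) (hab : d ^ 2 ≤ a * b)
    (hdet : 0 < c → (c * d - e * f) ^ 2 ≤ (a * c - e ^ 2) * (b * c - f ^ 2)) :
    ∃ w : Fin 3 → ℂ, Complex.normSq (w 0) = a ∧ Complex.normSq (w 1) = b ∧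
      Complex.normSq (w 2) = c ∧ (w 0 * star (w 1)).re ≤ d ∧
      (w 0 * star (w 2)).re = e ∧ (w 1 * star (w 2)).re = f := by
  rcases hc.eq_or_lt with rfl | hc
  · have he0 : e = 0 := by nlinarith
    have hf0 : f = 0 := by nlinarith
    refine ⟨![√a, -√b, 0], ?_⟩
    have : -(√a * √b) ≤ d := by
      rw [← Real.sqrt_mul ha]
      exact Real.neg_sqrt_le_of_sq_le hab
    simp [Complex.normSq_ofReal, ha, hb, he0, hf0, this]
  · have hA : 0 ≤ a * c - e ^ 2 := by linarith
    have hB : 0 ≤ b * c - f ^ 2 := by linarith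
    have hs : √c ≠ 0 := (Real.sqrt_pos.2 hc).ne'
    have hs2 := Real.sq_sqrt hc.le
    refine ⟨![⟨e / √c, √(a * c - e ^ 2) / √c⟩, ⟨f / √c, -√(b * c - f ^ 2) / √c⟩, √c],
      ?_, ?_, ?_, ?_, ?_, ?_⟩
    · simp only [Matrix.cons_val, Complex.normSq_mk]
      field_simp
      rw [Real.sq_sqrt hA, hs2]; ring
    · simp only [Matrix.cons_val, Complex.normSq_mk]
      field_simp
      rw [Real.sq_sqrt hB, hs2]; ring
    · simp [Complex.normSq_ofReal, hc.le]
    · have h1 := Real.neg_sqrt_le_of_sq_le (hdet hc)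
      rw [Real.sqrt_mul hA] at h1
      simp
      field_simp
      rw [hs2, mul_comm c b]
      linarith
    · simp; field_simp
    · simp; field_simp

theorem exists_spinor {s t : ℝ} {w : ℂ} (hs : 0 ≤ s) (ht : 0 ≤ t) (hw : Complex.normSq w = s * t) :
    ∃ ξ η : ℂ, Complex.normSq ξ = s ∧ Complex.normSq η = t ∧ ξ * star η = w := by
  rcases hs.eq_or_lt with rfl | hs
  · have : w = 0 := by simpa using hw
    exact ⟨0, √t, by simp [Complex.normSq_ofReal, ht, this]⟩
  · have h0 : √s ≠ 0 := (Real.sqrt_pos.2 hs).ne'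
    refine ⟨√s, star w / √s, by simp [Complex.normSq_ofReal, hs.le], ?_, ?_⟩
    · simp [Complex.normSq_ofReal, hs.le, hw]
      field_simp
    · have : (√s : ℂ) ≠ 0 := by exact_mod_cast h0
      simp
      field_simp

theorem normSq_wedge (ξ η ξ' η' : ℂ) :
    Complex.normSq (ξ * η' - ξ' * η) = Complex.normSq ξ * Complex.normSq η' +
      Complex.normSq ξ' * Complex.normSq η - 2 * ((ξ * star η) * star (ξ' * star η')).re := by
  simp [Complex.normSq_apply]
  ring

section Spectral

open Matrix
theorem Matrix.IsHermitian.dotProduct_mulVec_eq_sum {n : ℕ} {M : Matrix (Fin n) (Fin n) ℝ}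
    (hM : M.IsHermitian) (z : Fin n → ℝ) :
    z ⬝ᵥ M *ᵥ z = ∑ i, hM.eigenvalues i * ((hM.eigenvectorUnitary : Matrix _ _ ℝ)ᵀ *ᵥ z) i ^ 2 := by
  conv_lhs => rw [hM.spectral_theorem]
  rw [Unitary.conjStarAlgAut_apply, ← mulVec_mulVec, ← mulVec_mulVec, dotProduct_mulVec,
    ← mulVec_transpose, Matrix.star_eq_conjTranspose, conjTranspose_eq_transpose_of_trivial]
  simp only [dotProduct, mulVec_diagonal, Function.comp_apply, RCLike.ofReal_real_eq_id, id_eq]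
  exact Finset.sum_congr rfl fun i _ => by ring

theorem exists_dotProduct_mulVec_nonpos {n : ℕ} {M : Matrix (Fin n) (Fin n) ℝ}
    (hM : M.IsHermitian)
    (h : (Finset.univ.filter fun i => 0 < hM.eigenvalues i).card ≤ 1) :
    ∃ e : Fin n → ℝ, ∀ z, e ⬝ᵥ z = 0 → z ⬝ᵥ M *ᵥ z ≤ 0 := by
  by_cases hp : ∃ k, 0 < hM.eigenvalues k
  · obtain ⟨k, hk⟩ := hp
    refine ⟨(hM.eigenvectorUnitary : Matrix _ _ ℝ)ᵀ k, fun z hz => ?_⟩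
    rw [hM.dotProduct_mulVec_eq_sum]
    refine Finset.sum_nonpos fun i _ => ?_
    by_cases hi : 0 < hM.eigenvalues i
    · obtain rfl : i = k := Finset.card_le_one.1 h i (by simpa) k (by simpa)
      have : ((hM.eigenvectorUnitary : Matrix _ _ ℝ)ᵀ *ᵥ z) i = 0 := hz
      simp [this]
    · exact mul_nonpos_of_nonpos_of_nonneg (not_lt.1 hi) (sq_nonneg _)
  · push Not at hp
    refine ⟨0, fun z _ => ?_⟩
    rw [hM.dotProduct_mulVec_eq_sum]
    exact Finset.sum_nonpos fun i _ => mul_nonpos_of_nonpos_of_nonneg (hp i) (sq_nonneg _)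

theorem card_pos_eigenvalues_le_one {n : ℕ} {M : Matrix (Fin n) (Fin n) ℝ}
    (hM : M.IsHermitian)
    (e : Fin n → ℝ) (h : ∀ z, e ⬝ᵥ z = 0 → z ⬝ᵥ M *ᵥ z ≤ 0) :
    (Finset.univ.filter fun i => 0 < hM.eigenvalues i).card ≤ 1 := by
  refine Finset.card_le_one.2 fun i hi j hj => ?_
  by_contra hij
  simp only [Finset.mem_filter, Finset.mem_univ, true_and] at hi hj
  set U : Matrix (Fin n) (Fin n) ℝ := hM.eigenvectorUnitary.1
  have hU : Uᵀ * U = 1 := Unitary.coe_star_mul_self hM.eigenvectorUnitary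
  have main (y : Fin n → ℝ) (hy : e ⬝ᵥ U *ᵥ y = 0) : ∑ k, hM.eigenvalues k * y k ^ 2 ≤ 0 := by
    have := h _ hy
    rw [hM.dotProduct_mulVec_eq_sum] at this
    change ∑ k, hM.eigenvalues k * (Uᵀ *ᵥ U *ᵥ y) k ^ 2 ≤ 0 at this
    rwa [mulVec_mulVec, hU, one_mulVec] at this
  have pair (a b : ℝ) (hab : (e ᵥ* U) i * a + (e ᵥ* U) j * b = 0) :
      hM.eigenvalues i * a ^ 2 + hM.eigenvalues j * b ^ 2 ≤ 0 := by
    have := main (Pi.single i a + Pi.single j b) (by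
      rw [dotProduct_mulVec, dotProduct_add, dotProduct_single, dotProduct_single, hab])
    rw [Finset.sum_eq_add i j hij (fun k _ hk => by simp [hk.1, hk.2]) (by simp) (by simp)] at this
    simpa [hij, Ne.symm hij] using this
  by_cases h0 : (e ᵥ* U) i = 0
  · have := pair 1 0 (by simp [h0])
    linarith
  · have h1 := pair (-(e ᵥ* U) j) ((e ᵥ* U) i) (by ring)
    have h2 := mul_pos hj (pow_pos (abs_pos.2 h0) 2)
    rw [sq_abs] at h2
    have h3 := mul_nonneg hi.le (sq_nonneg (-(e ᵥ* U) j))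
    linarith

/-- The orthogonal complement of a positive vector of a Lorentzian form is negative semidefinite. -/
theorem nonpos_of_orthogonal {n : ℕ} {M : Matrix (Fin n) (Fin n) ℝ} (hM : M.IsSymm)
    {e : Fin n → ℝ} (h : ∀ z, e ⬝ᵥ z = 0 → z ⬝ᵥ M *ᵥ z ≤ 0) {a z : Fin n → ℝ}
    (ha : 0 < a ⬝ᵥ M *ᵥ a) (hz : a ⬝ᵥ M *ᵥ z = 0) : z ⬝ᵥ M *ᵥ z ≤ 0 := by
  have hz' : z ⬝ᵥ M *ᵥ a = 0 := by
    rw [dotProduct_comm, ← hz, dotProduct_mulVec, ← mulVec_transpose, hM.eq]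
  by_cases h0 : e ⬝ᵥ a = 0
  · exact absurd (h a h0) (not_le.2 ha)
  · have := h ((e ⬝ᵥ a) • z - (e ⬝ᵥ z) • a) (by simp; ring)
    simp only [mulVec_sub, mulVec_smul, dotProduct_sub, sub_dotProduct, smul_dotProduct,
      dotProduct_smul, smul_eq_mul, hz, hz'] at this
    have h1 : (0:ℝ) < (e ⬝ᵥ a) ^ 2 := by positivity
    have h2 := mul_nonneg (sq_nonneg (e ⬝ᵥ z)) ha.le
    by_contra h3
    have h4 := mul_pos h1 (not_le.1 h3)
    linarith

end Spectral

theorem mul_le_four_mul_of_nondegenerate {p q c A B C : ℝ} {x y : Fin 3 → ℝ} (hp : 0 < p)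
    (hq : 0 < q) (hc : 0 < c) (hA : 0 < A) (hB : 0 < B) (hC : 0 < C) (hy : ∀ i, 0 < y i)
    (hD : p * q < c ^ 2)
    (h : ∀ l m n : ℝ, (c ^ 2 - p * q) * (2 * (A * (l * m) + B * (l * n) + C * (m * n))) ≤
      2 * c * ((l * x 0 + m * x 1 + n * x 2) * (l * y 0 + m * y 1 + n * y 2)) -
      q * (l * x 0 + m * x 1 + n * x 2) ^ 2 - p * (l * y 0 + m * y 1 + n * y 2) ^ 2) :
    p * q * c * (A * B * C) ≤ 4 * (x 0 * y 0 * (x 1 * y 1) * (x 2 * y 2)) := by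
  have hD0 : 0 < c ^ 2 - p * q := by linarith
  obtain ⟨R, hR, hR2⟩ : ∃ R : ℝ, 0 < R ∧ R ^ 2 = c ^ 2 - p * q :=
    ⟨√(c ^ 2 - p * q), Real.sqrt_pos.2 hD0, Real.sq_sqrt hD0.le⟩
  have hRc : R < c := by nlinarith [mul_pos hp hq]
  set D := R ^ 2
  rw [← hR2] at h
  -- null coordinates
  let s : Fin 3 → ℝ := fun i => (c + R) * y i - q * x i
  let t : Fin 3 → ℝ := fun i => q * x i - (c - R) * y i
  have hst (i) : s i * t i = q * (2 * c * (x i * y i) - q * x i ^ 2 - p * y i ^ 2) := by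
    simp only [s, t]
    linear_combination y i ^ 2 * hR2
  have hadd (i) : s i + t i = 2 * R * y i := by simp only [s, t]; ring
  have hxy (i) : (c - R) * s i ^ 2 + 2 * c * (s i * t i) + (c + R) * t i ^ 2 =
      4 * D * q * (x i * y i) := by
    simp only [s, t, D]; ring
  obtain ⟨h0, h1, h2, h01, h02, h12, hdet⟩ := ternary_minors
    (a := s 0 * t 0) (b := s 1 * t 1) (c := s 2 * t 2)
    (d := (s 0 * t 1 + s 1 * t 0) / 2 - q * D * A) (e := (s 0 * t 2 + s 2 * t 0) / 2 - q * D * B)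
    (f := (s 1 * t 2 + s 2 * t 1) / 2 - q * D * C) fun l m n => by
      have := mul_le_mul_of_nonneg_left (h l m n) hq.le
      simp only [s, t]
      linear_combination this - (l * y 0 + m * y 1 + n * y 2) ^ 2 * hR2
  have hs (i) (hi : 0 ≤ s i * t i) : 0 ≤ s i ∧ 0 ≤ t i := by
    have := mul_pos (mul_pos two_pos hR) (hy i)
    rw [← hadd] at this
    constructor <;> by_contra hneg <;> nlinarith
  obtain ⟨w, hw0, hw1, hw2, hw01, hw02, hw12⟩ := exists_planar_gram h0 h1 h2 h02 h12 h01 hdet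
  have hw : ∀ i, 0 ≤ s i ∧ 0 ≤ t i ∧ Complex.normSq (w i) = s i * t i := by
    intro i
    fin_cases i
    · exact ⟨(hs 0 h0).1, (hs 0 h0).2, hw0⟩
    · exact ⟨(hs 1 h1).1, (hs 1 h1).2, hw1⟩
    · exact ⟨(hs 2 h2).1, (hs 2 h2).2, hw2⟩
  choose ξ η hξ hη hξη using fun i => exists_spinor (hw i).1 (hw i).2.1 (hw i).2.2
  have had := vandermonde_hadamard (k := c - R) (l := 2 * c) (m := c + R) (by linarith)
    (by linarith) (by linarith) ξ η
  simp only [normSq_wedge, hξ, hη, hξη, hxy, Fin.prod_univ_three] at had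
  have hqD : 0 < q * D := mul_pos hq (hR2 ▸ hD0)
  have e0 : 2 * (q * D * A) ≤ s 0 * t 1 + s 1 * t 0 - 2 * (w 0 * star (w 1)).re := by linarith
  have e1 : 2 * (q * D * B) ≤ s 0 * t 2 + s 2 * t 0 - 2 * (w 0 * star (w 2)).re := by linarith
  have e2 : 2 * (q * D * C) ≤ s 1 * t 2 + s 2 * t 1 - 2 * (w 1 * star (w 2)).re := by linarith
  have hprod := mul_le_mul (mul_le_mul e0 e1 (by positivity) (le_trans (by positivity) e0)) e2
    (by positivity) (mul_nonneg (le_trans (by positivity) e0) (le_trans (by positivity) e1))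
  have hk : (c - R) * (2 * c) * (c + R) = 2 * c * (p * q) := by
    linear_combination (-2 * c) * hR2
  rw [hk] at had
  have := (mul_le_mul_of_nonneg_left hprod (by positivity : 0 ≤ 2 * c * (p * q))).trans had
  have hpos : 0 < 16 * (q * D) ^ 3 := by positivity
  refine le_of_mul_le_mul_left ?_ hpos
  linarith

open Matrix in
theorem mul_le_four_mul_of_isLorentzian {M : Matrix (Fin 5) (Fin 5) ℝ} (hM : IsLorentzian M)
    (hpos : ∀ i j, 0 < M i j) {p : ℝ} (hp : 0 < p) (hpM : p < M 3 3) :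
    p * M 4 4 * M 3 4 * (M 0 1 * M 0 2 * M 1 2) ≤
      4 * (M 0 3 * M 0 4 * (M 1 3 * M 1 4) * (M 2 3 * M 2 4)) := by
  obtain ⟨hS, -, hev⟩ := hM
  have hH : M.IsHermitian := by
    rw [Matrix.IsHermitian, conjTranspose_eq_transpose_of_trivial, hS.eq]
  obtain ⟨e, he⟩ := exists_dotProduct_mulVec_nonpos hH (hev hH)
  have hs (i j) : M i j = M j i := hS.apply j i
  have hcauchy : M 3 3 * M 4 4 ≤ M 3 4 ^ 2 := by
    have := nonpos_of_orthogonal hS he (a := ![0, 0, 0, 1, 0]) (z := ![0, 0, 0, -M 3 4, M 3 3])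
      (by simpa [dotProduct, mulVec, Fin.sum_univ_five] using hpos 3 3)
      (by simp [dotProduct, mulVec, Fin.sum_univ_five]; ring)
    simp [dotProduct, mulVec, Fin.sum_univ_five, hs 4 3] at this
    have h3 := hpos 3 3
    refine le_of_mul_le_mul_left ?_ h3
    linarith
  have hD : p * M 4 4 < M 3 4 ^ 2 :=
    (mul_lt_mul_of_pos_right hpM (hpos 4 4)).trans_le hcauchy
  -- lowering diagonal entries keeps the matrix Lorentzian
  let N : Matrix (Fin 5) (Fin 5) ℝ := M - diagonal ![M 0 0, M 1 1, M 2 2, M 3 3 - p, 0]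
  have hN : N.IsSymm := hS.sub (isSymm_diagonal _)
  have heN : ∀ z, e ⬝ᵥ z = 0 → z ⬝ᵥ N *ᵥ z ≤ 0 := fun z hz => by
    refine le_trans ?_ (he z hz)
    simp only [N, sub_mulVec, dotProduct_sub]
    refine sub_le_self _ (Finset.sum_nonneg fun i _ => ?_)
    rw [mulVec_diagonal, mul_left_comm]
    refine mul_nonneg ?_ (mul_self_nonneg _)
    fin_cases i <;> simp [(hpos _ _).le, hpM.le]
  refine mul_le_four_mul_of_nondegenerate (x := fun i => ![M 0 3, M 1 3, M 2 3] i)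
    (y := fun i => ![M 0 4, M 1 4, M 2 4] i) hp (hpos 4 4) (hpos 3 4) (hpos 0 1) (hpos 0 2)
    (hpos 1 2) (fun i => by fin_cases i <;> simp [hpos]) hD fun l m n => ?_
  set X := l * M 0 3 + m * M 1 3 + n * M 2 3 with hX
  set Y := l * M 0 4 + m * M 1 4 + n * M 2 4 with hY
  set D := M 3 4 ^ 2 - p * M 4 4 with hDdef
  have hD0 : 0 < D := by linarith
  have := nonpos_of_orthogonal hN heN (a := ![0, 0, 0, 1, 0])
    (z := ![D * l, D * m, D * n, M 4 4 * X - M 3 4 * Y, p * Y - M 3 4 * X])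
    (by simpa [N, dotProduct, mulVec, Fin.sum_univ_five, diagonal] using hp)
    (by
      simp [N, dotProduct, mulVec, Fin.sum_univ_five, diagonal, hs 3]
      rw [hs 4 3, hX, hY, hDdef]
      ring)
  simp [N, dotProduct, mulVec, Fin.sum_univ_five, diagonal, hs 1 0, hs 2 0, hs 3 0, hs 4 0, hs 2 1,
    hs 3 1, hs 4 1, hs 3 2, hs 4 2, hs 4 3] at this
  simp only [cons_val]
  refine le_of_mul_le_mul_left ?_ hD0
  rw [← sub_nonpos]
  refine le_trans (le_of_eq ?_) this
  rw [hX, hY, hDdef]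
  ring

open Matrix Filter Topology in
theorem exists_isLorentzian_lt {c : ℝ} (hc : c < 4) : ∃ M : Matrix (Fin 5) (Fin 5) ℝ,
      IsLorentzian M ∧ (∀ i j, 0 < M i j) ∧
      c < (M 0 1 * M 0 2 * M 1 2 * M 3 3 * M 3 4 * M 4 4) /
            (M 0 3 * M 0 4 * M 1 3 * M 1 4 * M 2 3 * M 2 4) := by
  let f : ℝ → ℝ := fun δ => (4 + 2 * δ) * (1 + δ ^ 2 * (δ + δ ^ 2)) ^ 2 * 4 * (1 + δ) /
    ((2 + δ) ^ 2 * (1 + δ + δ ^ 2) ^ 2 * (1 + δ ^ 3) * (1 + δ ^ 2))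
  have hf : ContinuousAt f 0 := by
    refine ContinuousAt.div (by fun_prop) (by fun_prop) (by norm_num)
  have hf0 : c < f 0 := by norm_num [f, hc]
  have hev : ∀ᶠ δ in 𝓝[>] (0 : ℝ), c < f δ :=
    (hf.eventually (lt_mem_nhds hf0)).filter_mono nhdsWithin_le_nhds
  obtain ⟨δ, hδ, hδ0 : 0 < δ⟩ := (hev.and self_mem_nhdsWithin).exists
  let M : Matrix (Fin 5) (Fin 5) ℝ :=
    !![2 * δ ^ 2, 4 * δ + 2 * δ ^ 2, 1 + (δ + δ ^ 2) * δ ^ 2, 2 * δ + δ ^ 2, 1 + δ + δ ^ 2;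
      4 * δ + 2 * δ ^ 2, 2 * δ ^ 2, 1 + (δ + δ ^ 2) * δ ^ 2, 2 * δ + δ ^ 2, 1 + δ + δ ^ 2;
      1 + (δ + δ ^ 2) * δ ^ 2, 1 + (δ + δ ^ 2) * δ ^ 2, 2 * δ ^ 2, 1 + δ ^ 3, 1 + δ ^ 2;
      2 * δ + δ ^ 2, 2 * δ + δ ^ 2, 1 + δ ^ 3, 2 * δ, 1 + δ;
      1 + δ + δ ^ 2, 1 + δ + δ ^ 2, 1 + δ ^ 2, 1 + δ, 2]
  have hpos : ∀ i j, 0 < M i j := by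
    intro i j
    fin_cases i <;> fin_cases j <;> simp [M] <;> positivity
  refine ⟨M, ⟨?_, fun i j => (hpos i j).le, fun hM => ?_⟩, hpos, hδ.trans_eq ?_⟩
  · ext i j
    fin_cases i <;> fin_cases j <;> rfl
  · -- `M` is the Gram matrix of the form `2 * S * T - 2 * W ^ 2`
    refine card_pos_eigenvalues_le_one hM
      ![1 + δ + δ ^ 2, 1 + δ + δ ^ 2, 1 + δ ^ 2, 1 + δ, 2] fun z hz => ?_
    simp [dotProduct, Fin.sum_univ_five] at hz
    have h1 : 0 ≤ ((δ + δ ^ 2) * (z 0 + z 1) + z 2 + δ * z 3 + z 4) ^ 2 +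
        δ * (z 0 - z 1) ^ 2 := by positivity
    have h2 : z 0 + z 1 + δ ^ 2 * z 2 + z 3 + z 4 =
      -((δ + δ ^ 2) * (z 0 + z 1) + z 2 + δ * z 3 + z 4) := by linarith
    have h3 : z ⬝ᵥ M *ᵥ z = 2 * (((δ + δ ^ 2) * (z 0 + z 1) + z 2 + δ * z 3 + z 4) *
        (z 0 + z 1 + δ ^ 2 * z 2 + z 3 + z 4)) - 2 * (δ * (z 0 - z 1) ^ 2) := by
      simp [M, dotProduct, mulVec, Fin.sum_univ_five]
      ring
    rw [h3, h2]
    linarith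
  · simp [M, f]
    field_simp
    ring

theorem pentagonal_sup_eq_four :
    (∀ M : Matrix (Fin 5) (Fin 5) ℝ, IsLorentzian M → (∀ i j, 0 < M i j) →
      (M 0 1 * M 0 2 * M 1 2 * M 3 3 * M 3 4 * M 4 4) /
        (M 0 3 * M 0 4 * M 1 3 * M 1 4 * M 2 3 * M 2 4) ≤ 4) ∧
    (∀ c : ℝ, c < 4 → ∃ M : Matrix (Fin 5) (Fin 5) ℝ,
      IsLorentzian M ∧ (∀ i j, 0 < M i j) ∧
      c < (M 0 1 * M 0 2 * M 1 2 * M 3 3 * M 3 4 * M 4 4) /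
            (M 0 3 * M 0 4 * M 1 3 * M 1 4 * M 2 3 * M 2 4)) := by
  refine ⟨fun M hM hpos => ?_, fun c hc => exists_isLorentzian_lt hc⟩
  have hden : 0 < M 0 3 * M 0 4 * M 1 3 * M 1 4 * M 2 3 * M 2 4 := by simp [hpos]
  have hK : 0 < M 4 4 * M 3 4 * (M 0 1 * M 0 2 * M 1 2) := by simp [hpos]
  have hle : M 3 3 ≤ 4 * (M 0 3 * M 0 4 * (M 1 3 * M 1 4) * (M 2 3 * M 2 4)) /
      (M 4 4 * M 3 4 * (M 0 1 * M 0 2 * M 1 2)) := by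
    refine le_of_forall_lt_imp_le_of_dense fun p hp => ?_
    rcases le_or_gt p 0 with hp0 | hp0
    · exact hp0.trans (div_nonneg (by linarith) hK.le)
    · rw [le_div_iff₀ hK]
      linarith [mul_le_four_mul_of_isLorentzian hM hpos hp0 hp]
  rw [le_div_iff₀ hK] at hle
  rw [div_le_iff₀ hden]
  linarith
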